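/- arXiv:math-ph/0205011 — 6 statements merged into one kernel-verified Lean document; each statement's English description precedes it below -/
import Mathlib

section
/- Let n ≥ 1 and l ≥ 3 be integers, let W ∈ L¹(ℝ^{(l−1)n}), let f : ℝⁿ → ℝ be continuous with compact support, and let X₁, …, X_l ∈ ℝⁿ. Then lim_{R→∞} R^{−ln/2} ∫_{(ℝⁿ)^l} W(x₁−x₂+R(X₁−X₂), …, x_{l−1}−x_l+R(X_{l−1}−X_l)) · ∏_{i=1}^{l} f(x_i/R) dx₁⋯dx_l = 0. -/
open MeasureTheory Filter

section DifferenceCoordinates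

variable {V : Type*} [NormedAddCommGroup V] [NormedSpace ℝ V]

/-- The map sending `x` to its successive differences and its last entry. -/
def differenceMap (V : Type*) [NormedAddCommGroup V] [NormedSpace ℝ V] (k : ℕ) :
    (Fin (k + 1) → V) →ₗ[ℝ] (Fin k → V) × V where
  toFun x := (fun i => x i.castSucc - x i.succ, x (Fin.last k))
  map_add' x y := by
    ext i
    · simp only [Pi.add_apply, Prod.fst_add]; abel
    · rfl
  map_smul' c x := by
    ext i
    · simp [smul_sub]
    · rfl

theorem differenceMap_injective (k : ℕ) : Function.Injective (differenceMap V k) := by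
  rw [injective_iff_map_eq_zero]
  intro x hx
  obtain ⟨hdiff, hlast⟩ := Prod.ext_iff.mp hx
  funext i
  induction i using Fin.reverseInduction with
  | last => exact hlast
  | cast i ih => exact (sub_eq_zero.mp (congrFun hdiff i)).trans ih

variable [FiniteDimensional ℝ V]

/-- Successive differences and the last entry are linear coordinates. -/
noncomputable def differenceEquiv (V : Type*) [NormedAddCommGroup V] [NormedSpace ℝ V]
    [FiniteDimensional ℝ V] (k : ℕ) : (Fin (k + 1) → V) ≃L[ℝ] (Fin k → V) × V :=
  ((differenceMap V k).linearEquivOfInjective (differenceMap_injective k) (by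
    simp [Module.finrank_pi_fintype, add_mul])).toContinuousLinearEquiv

theorem differenceEquiv_apply (k : ℕ) (x : Fin (k + 1) → V) :
    differenceEquiv V k x = (fun i => x i.castSucc - x i.succ, x (Fin.last k)) := rfl

variable [MeasureSpace V] [BorelSpace V] [(volume : Measure V).IsAddHaarMeasure]

theorem exists_map_differenceEquiv_eq_smul (k : ℕ) :
    ∃ c : ENNReal, c ≠ ⊤ ∧ (volume : Measure (Fin (k + 1) → V)).map (differenceEquiv V k) =
      c • (volume : Measure (Fin k → V)).prod (volume : Measure V) := by
  have : (volume : Measure (Fin (k + 1) → V)).IsAddHaarMeasure :=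
    inferInstanceAs (Measure.pi fun _ => volume).IsAddHaarMeasure
  have : (volume : Measure (Fin k → V)).IsAddHaarMeasure :=
    inferInstanceAs (Measure.pi fun _ => volume).IsAddHaarMeasure
  have : ((volume : Measure (Fin (k + 1) → V)).map (differenceEquiv V k)).IsAddHaarMeasure :=
    (differenceEquiv V k).isAddHaarMeasure_map _
  exact ⟨_, ENNReal.coe_ne_top, Measure.isAddLeftInvariant_eq_smul _ _⟩

/-- The integral of a function of the differences times a product of bounded functions is
controlled by `L¹` norms, up to a constant depending only on the space. -/
theorem exists_norm_integral_differences_mul_prod_le (k : ℕ) :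
    ∃ C : ℝ, ∀ (w : (Fin k → V) → ℝ) (g : V → ℝ) (M : ℝ), Integrable w → Integrable g →
      (∀ v, |g v| ≤ M) →
      ‖∫ x : Fin (k + 1) → V, w (fun i => x i.castSucc - x i.succ) * ∏ i, g (x i)‖ ≤
        M ^ k * (C * ((∫ y, |w y|) * ∫ v, |g v|)) := by
  obtain ⟨c, hc, hmap⟩ := exists_map_differenceEquiv_eq_smul (V := V) k
  refine ⟨c.toReal, fun w g M hw hg hM => ?_⟩
  have hemb : MeasurableEmbedding (differenceEquiv V k) :=
    (differenceEquiv V k).toHomeomorph.measurableEmbedding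
  let G : (Fin k → V) × V → ℝ := fun p => |w p.1| * |g p.2|
  have hG : Integrable G (volume.map (differenceEquiv V k)) := by
    rw [hmap]
    exact (hw.abs.mul_prod hg.abs).smul_measure hc
  have hGint : ∫ x, G (differenceEquiv V k x) = c.toReal * ((∫ y, |w y|) * ∫ v, |g v|) := by
    rw [← hemb.integral_map, hmap, integral_smul_measure, smul_eq_mul]
    exact congrArg (c.toReal * ·) (integral_prod_mul (fun y => |w y|) fun v => |g v|)
  rw [← hGint, ← integral_const_mul]
  refine norm_integral_le_of_norm_le ((hemb.integrable_map_iff.mp hG).const_mul _)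
    (Eventually.of_forall fun x => ?_)
  have hprod : ∏ i : Fin k, |g (x i.castSucc)| ≤ M ^ k := by
    simpa using Finset.prod_le_prod (s := Finset.univ)
      (fun i _ => abs_nonneg (g (x (Fin.castSucc i)))) fun i _ => hM (x (Fin.castSucc i))
  simp only [G, differenceEquiv_apply, Real.norm_eq_abs, abs_mul, Finset.abs_prod]
  rw [Fin.prod_univ_castSucc]
  calc _ = (∏ i : Fin k, |g (x i.castSucc)|) *
        (|w fun i => x i.castSucc - x i.succ| * |g (x (Fin.last k))|) := by ring
    _ ≤ _ := by gcongr

end DifferenceCoordinates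

/-- Section 2.2, Case 1 (`l ≥ 3`): with normal scaling exponent `n/2` and an
integrable (`L¹`) truncated `l`-point function `W` in the difference variables,
the scaled truncated correlation of the block observables vanishes in the
scaling limit.  Here the number of observables is `l = k + 1` with `k ≥ 2`,
so `l ≥ 3`, and `W` is a function of the `l - 1 = k` difference variables. -/
theorem statement0 (n k : ℕ) (hn : 1 ≤ n) (hk : 2 ≤ k)
    (W : (Fin k → EuclideanSpace ℝ (Fin n)) → ℝ) (hW : Integrable W)
    (f : EuclideanSpace ℝ (Fin n) → ℝ) (hf : Continuous f)
    (hfsupp : HasCompactSupport f)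
    (X : Fin (k + 1) → EuclideanSpace ℝ (Fin n)) :
    Tendsto (fun R : ℝ =>
        R ^ (-(((k + 1) * n : ℕ) : ℝ) / 2) *
          ∫ x : Fin (k + 1) → EuclideanSpace ℝ (Fin n),
            W (fun i => (x i.castSucc - x i.succ) + R • (X i.castSucc - X i.succ)) *
              ∏ i, f (R⁻¹ • x i))
      atTop (nhds 0) := by
  obtain ⟨C, hC⟩ :=
    exists_norm_integral_differences_mul_prod_le (V := EuclideanSpace ℝ (Fin n)) k
  obtain ⟨M, hM⟩ := hf.bounded_above_of_compact_support hfsupp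
  have hfint : Integrable f := hf.integrable_of_hasCompactSupport hfsupp
  set K : ℝ := M ^ k * (C * ((∫ y, |W y|) * ∫ v, |f v|))
  have hexp : 0 < (((k : ℝ) - 1) * n) / 2 := by
    have hk' : (2 : ℝ) ≤ k := by exact_mod_cast hk
    have hn' : (1 : ℝ) ≤ n := by exact_mod_cast hn
    have : 0 < (k : ℝ) - 1 := by linarith
    positivity
  have hlim : Tendsto (fun R : ℝ => R ^ (-((((k : ℝ) - 1) * n) / 2)) * K) atTop (nhds 0) := by
    simpa using (tendsto_rpow_neg_atTop hexp).mul_const K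
  refine squeeze_zero_norm' ?_ hlim
  filter_upwards [eventually_gt_atTop (0 : ℝ)] with R hR
  have hbound := hC (fun y => W (y + fun i => R • (X i.castSucc - X i.succ)))
    (fun v => f (R⁻¹ • v)) M (hW.comp_add_right _)
    (hfint.comp_smul (inv_ne_zero hR.ne')) fun v => hM _
  rw [integral_add_right_eq_self (fun y => |W y|),
    Measure.integral_comp_inv_smul_of_nonneg volume (fun v => |f v|) hR.le,
    finrank_euclideanSpace_fin, smul_eq_mul] at hbound
  rw [norm_mul, Real.norm_of_nonneg (Real.rpow_nonneg hR.le _)]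
  calc _ ≤ R ^ (-(((k + 1) * n : ℕ) : ℝ) / 2) *
        (M ^ k * (C * ((∫ y, |W y|) * (R ^ n * ∫ v, |f v|)))) :=
        mul_le_mul_of_nonneg_left hbound (Real.rpow_nonneg hR.le _)
    _ = R ^ (-(((k + 1) * n : ℕ) : ℝ) / 2) * R ^ (n : ℝ) * K := by
        rw [Real.rpow_natCast]; ring
    _ = _ := by
        rw [← Real.rpow_add hR]
        congr 2
        push_cast
        ring
end

section
/- Let n ≥ 1, 0 < α < n, c ∈ ℝ, and let F : ℝⁿ → ℝ be a bounded measurable function with F(x) → 0 as |x| → ∞. Set W(x) = (c + F(x)) · (1+|x|²)^{−(n−α)/2}. Let f : ℝⁿ → ℝ be continuous with compact support and let Y ∈ ℝⁿ be such that y + Y ≠ 0 for every y in the support of the autocorrelation f⋆f, where (f⋆f)(y) = ∫ f(y+x)f(x)dx. Then lim_{R→∞} R^{−(n+α)} ∫_{ℝⁿ×ℝⁿ} W((x₁−x₂)+RY) f(x₁/R) f(x₂/R) dx₁dx₂ = c · ∫_{ℝⁿ} |y+Y|^{−(n−α)} (f⋆f)(y) dy. -/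
open MeasureTheory Filter

section Autocorrelation

variable {E : Type*} [NormedAddCommGroup E] [NormedSpace ℝ E] [FiniteDimensional ℝ E]
  [MeasurableSpace E] [BorelSpace E] {μ : Measure E} [μ.IsAddHaarMeasure]

/-- The shear `(y, x) ↦ (y + x, x)` is a measurable embedding. -/
theorem measurableEmbedding_add_prod :
    MeasurableEmbedding (fun z : E × E => (z.1 + z.2, z.2)) := by
  have : CompleteSpace E := FiniteDimensional.complete ℝ E
  refine Continuous.measurableEmbedding (by fun_prop) fun a b h => ?_
  simp only [Prod.mk.injEq] at h
  exact Prod.ext (by simpa [h.2] using h.1) h.2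

theorem integrable_mul_sheared {f : E → ℝ} (hf : Integrable f μ) :
    Integrable (fun z : E × E => f (z.1 + z.2) * f z.2) (μ.prod μ) :=
  ((measurePreserving_add_prod μ μ).integrable_comp_emb
    measurableEmbedding_add_prod).2 (hf.mul_prod hf)

/-- A double integral against a function of the difference is a single integral against the
autocorrelation. -/
theorem integral_prod_sub_eq_integral_autocorrelation {f w : E → ℝ} (hf : Integrable f μ)
    (hw : Measurable w) {C : ℝ} (hC : ∀ x, |w x| ≤ C) :
    ∫ p : E × E, w (p.1 - p.2) * f p.1 * f p.2 ∂(μ.prod μ) =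
      ∫ y, w y * ∫ x, f (y + x) * f x ∂μ ∂μ := by
  rw [← (measurePreserving_add_prod μ μ).integral_comp measurableEmbedding_add_prod]
  simp only [add_sub_cancel_right, mul_assoc]
  have hint : Integrable (fun z : E × E => w z.1 * (f (z.1 + z.2) * f z.2)) (μ.prod μ) :=
    (integrable_mul_sheared hf).bdd_mul (hw.comp measurable_fst).aestronglyMeasurable
      (.of_forall fun z => hC z.1)
  rw [integral_prod _ hint]
  simp only [integral_const_mul]

/-- The block-averaged two-point integral, rewritten in the rescaled variables. -/
theorem integral_block_eq_integral_autocorrelation {f W : E → ℝ} (hf : Integrable f μ)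
    (hW : Measurable W) {C : ℝ} (hC : ∀ x, |W x| ≤ C) (Y : E) {R : ℝ} (hR : 0 < R) :
    ∫ p : E × E, W (p.1 - p.2 + R • Y) * f (R⁻¹ • p.1) * f (R⁻¹ • p.2) ∂(μ.prod μ) =
      R ^ (2 * Module.finrank ℝ E) *
        ∫ y, W (R • (y + Y)) * ∫ x, f (y + x) * f x ∂μ ∂μ := by
  have hw : Measurable fun y => W (R • (y + Y)) := hW.comp (by fun_prop)
  rw [← integral_prod_sub_eq_integral_autocorrelation hf hw fun x => hC _]
  have := Measure.integral_comp_inv_smul_of_nonneg (μ.prod μ)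
    (fun q : E × E => W (R • (q.1 - q.2 + Y)) * f q.1 * f q.2) hR.le
  simp only [Prod.smul_fst, Prod.smul_snd, ← smul_sub, smul_add, smul_inv_smul₀ hR.ne',
    Module.finrank_prod, ← two_mul, smul_eq_mul] at this
  simpa only [smul_add] using this

end Autocorrelation

/-- Multiplying the regularized power law at scale `R` by the matching power of `R` amounts to
regularizing at `R⁻²`. -/
theorem rpow_mul_one_add_sq_rpow {R r : ℝ} (hR : 0 < R) (β : ℝ) :
    R ^ β * (1 + (R * r) ^ 2) ^ (-β / 2) = ((R⁻¹) ^ 2 + r ^ 2) ^ (-β / 2) := by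
  have h : 1 + (R * r) ^ 2 = R ^ 2 * ((R⁻¹) ^ 2 + r ^ 2) := by
    field_simp
  have h2 : (R ^ 2) ^ (-β / 2) = R ^ (-β) := by
    rw [← Real.rpow_natCast, ← Real.rpow_mul hR.le]
    congr 1
    push_cast
    ring
  rw [h, Real.mul_rpow (by positivity) (by positivity), h2, ← mul_assoc, ← Real.rpow_add hR]
  simp

theorem sq_rpow_neg_div_two {r : ℝ} (hr : 0 ≤ r) (β : ℝ) :
    (r ^ 2) ^ (-β / 2) = r ^ (-β) := by
  rw [← Real.rpow_natCast, ← Real.rpow_mul hr]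
  congr 1
  push_cast
  ring

theorem tendsto_regularized_rpow {r : ℝ} (hr : 0 < r) (β : ℝ) :
    Tendsto (fun R : ℝ => ((R⁻¹) ^ 2 + r ^ 2) ^ (-β / 2)) atTop (nhds (r ^ (-β))) := by
  have h : Tendsto (fun R : ℝ => (R⁻¹) ^ 2 + r ^ 2) atTop (nhds (r ^ 2)) := by
    simpa using (tendsto_inv_atTop_zero.pow 2).add_const (r ^ 2)
  rw [← sq_rpow_neg_div_two hr.le]
  exact h.rpow_const (Or.inl (by positivity))

theorem regularized_rpow_le {R r δ β : ℝ} (hδ : 0 < δ) (hr : δ ≤ r) (hβ : 0 ≤ β) :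
    ((R⁻¹) ^ 2 + r ^ 2) ^ (-β / 2) ≤ δ ^ (-β) := by
  rw [← sq_rpow_neg_div_two hδ.le]
  refine Real.rpow_le_rpow_of_nonpos (by positivity) ?_ (by linarith)
  nlinarith [sq_nonneg R⁻¹]

/-- A function vanishing at infinity tends to zero along the dilates of a nonzero vector. -/
theorem tendsto_smul_atTop_of_cocompact {E : Type*} [NormedAddCommGroup E] [NormedSpace ℝ E]
    [ProperSpace E] {F : E → ℝ} (hF : Tendsto F (cocompact E) (nhds 0)) {z : E} (hz : z ≠ 0) :
    Tendsto (fun R : ℝ => F (R • z)) atTop (nhds 0) := by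
  refine hF.comp ?_
  rw [← Metric.cobounded_eq_cocompact, ← tendsto_norm_atTop_iff_cobounded]
  simp only [norm_smul, Real.norm_eq_abs]
  exact tendsto_abs_atTop_atTop.atTop_mul_const (norm_pos_iff.2 hz)

/-- Method One (Sections 2.3 and 4.1): at the critical point, with
`W(x) = (c + F(x))·(1 + |x|²)^{-(n-α)/2}` (power-law clustering with anomalous
exponent `0 < α < n`, `F` bounded and vanishing at infinity) and critical
scaling exponent `γ = (n+α)/2` (so the prefactor is `R^{-2γ} = R^{-(n+α)}`),
the scaled truncated two-point function of the block observables converges to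
`c · ∫ |y+Y|^{-(n-α)} (f⋆f)(y) dy`, provided `y + Y ≠ 0` on the support of the
autocorrelation `f⋆f`. -/
theorem statement2 (n : ℕ) (hn : 1 ≤ n) (α : ℝ) (hα0 : 0 < α) (hαn : α < n)
    (c : ℝ) (F : EuclideanSpace ℝ (Fin n) → ℝ) (hFmeas : Measurable F)
    (hFbdd : ∃ C, ∀ x, |F x| ≤ C)
    (hFdecay : Tendsto F (cocompact (EuclideanSpace ℝ (Fin n))) (nhds 0))
    (W : EuclideanSpace ℝ (Fin n) → ℝ)
    (hW : ∀ x, W x = (c + F x) * (1 + ‖x‖ ^ 2) ^ (-((n : ℝ) - α) / 2))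
    (f : EuclideanSpace ℝ (Fin n) → ℝ) (hf : Continuous f)
    (hfsupp : HasCompactSupport f)
    (Y : EuclideanSpace ℝ (Fin n))
    (hY : ∀ y ∈ tsupport (fun y => ∫ x, f (y + x) * f x), y + Y ≠ 0) :
    Tendsto (fun R : ℝ =>
        R ^ (-((n : ℝ) + α)) *
          ∫ p : EuclideanSpace ℝ (Fin n) × EuclideanSpace ℝ (Fin n),
            W (p.1 - p.2 + R • Y) * f (R⁻¹ • p.1) * f (R⁻¹ • p.2))
      atTop
      (nhds (c * ∫ y, ‖y + Y‖ ^ (-((n : ℝ) - α)) * ∫ x, f (y + x) * f x)) := by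
  obtain ⟨C, hC⟩ := hFbdd
  have hβ : 0 ≤ (n : ℝ) - α := by linarith
  have hcF : ∀ x, |c + F x| ≤ |c| + C := fun x => (abs_add_le _ _).trans (by gcongr; exact hC x)
  have hK : 0 ≤ |c| + C := (abs_nonneg _).trans (hcF 0)
  have hfint : Integrable f := hf.integrable_of_hasCompactSupport hfsupp
  have hWmeas : Measurable W := by
    rw [funext hW]
    fun_prop
  have hWbdd : ∀ x, |W x| ≤ |c| + C := fun x => by
    have h1 : ((1 : ℝ) + ‖x‖ ^ 2) ^ (-((n : ℝ) - α) / 2) ≤ 1 :=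
      Real.rpow_le_one_of_one_le_of_nonpos (by nlinarith [sq_nonneg ‖x‖]) (by linarith)
    rw [hW, abs_mul, abs_of_nonneg (a := (1 + ‖x‖ ^ 2) ^ (-((n : ℝ) - α) / 2)) (by positivity)]
    exact (mul_le_of_le_one_right (abs_nonneg _) h1).trans (hcF x)
  set A : EuclideanSpace ℝ (Fin n) → ℝ := fun y => ∫ x, f (y + x) * f x with hA
  have hAint : Integrable A := (integrable_mul_sheared hfint).integral_prod_left
  obtain ⟨δ, hδ, hδA⟩ : ∃ δ > 0, ∀ y, A y ≠ 0 → δ ≤ ‖y + Y‖ := by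
    have hmem : -Y ∈ (tsupport A)ᶜ := fun h => hY _ h (neg_add_cancel Y)
    obtain ⟨δ, hδ, hball⟩ := Metric.isOpen_iff.1 (isClosed_tsupport A).isOpen_compl _ hmem
    refine ⟨δ, hδ, fun y hy => ?_⟩
    by_contra! hlt
    exact hball (by simpa [dist_eq_norm] using hlt) (subset_tsupport A hy)
  have hscale : ∀ R : ℝ, 0 < R → ∀ z, R ^ ((n : ℝ) - α) * W (R • z) =
      (c + F (R • z)) * ((R⁻¹) ^ 2 + ‖z‖ ^ 2) ^ (-((n : ℝ) - α) / 2) := fun R hR z => by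
    rw [hW, ← rpow_mul_one_add_sq_rpow hR, norm_smul, Real.norm_of_nonneg hR.le]
    ring
  rw [← integral_const_mul]
  have hlim : Tendsto (fun R : ℝ => ∫ y, R ^ ((n : ℝ) - α) * W (R • (y + Y)) * A y) atTop
      (nhds (∫ y, c * (‖y + Y‖ ^ (-((n : ℝ) - α)) * A y))) := by
    refine tendsto_integral_filter_of_dominated_convergence
      (fun y => (|c| + C) * δ ^ (-((n : ℝ) - α)) * ‖A y‖) (.of_forall fun R => ?_) ?_
      (hAint.norm.const_mul _) (.of_forall fun y => ?_)
    · have : Measurable fun y => R ^ ((n : ℝ) - α) * W (R • (y + Y)) :=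
        (hWmeas.comp (by fun_prop)).const_mul _
      exact this.aestronglyMeasurable.mul hAint.aestronglyMeasurable
    · filter_upwards [eventually_gt_atTop 0] with R hR
      refine .of_forall fun y => ?_
      by_cases hy : A y = 0
      · simp [hy]
      rw [norm_mul, hscale R hR, norm_mul, Real.norm_eq_abs, Real.norm_of_nonneg (by positivity)]
      gcongr
      · exact hcF _
      · exact regularized_rpow_le hδ (hδA y hy) hβ
    · by_cases hy : A y = 0
      · simp [hy]
      have hz : 0 < ‖y + Y‖ := hδ.trans_le (hδA y hy)
      have hF0 := tendsto_smul_atTop_of_cocompact hFdecay (norm_pos_iff.1 hz)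
      have := ((hF0.const_add c).mul (tendsto_regularized_rpow hz ((n : ℝ) - α))).mul_const (A y)
      rw [add_zero, mul_assoc] at this
      refine this.congr' ?_
      filter_upwards [eventually_gt_atTop 0] with R hR
      rw [hscale R hR]
  refine hlim.congr' ?_
  filter_upwards [eventually_gt_atTop 0] with R hR
  rw [Measure.volume_eq_prod, integral_block_eq_integral_autocorrelation hfint hWmeas hWbdd Y hR,
    finrank_euclideanSpace_fin, ← mul_assoc, ← Real.rpow_natCast, ← Real.rpow_add hR,
    ← integral_const_mul]
  congr! 2 with y
  rw [mul_assoc]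
  congr 2
  push_cast
  ring
end

section
/- Let 𝓐 be a (complex or real) Banach algebra, n ≥ 1, and let A, B : ℝⁿ → 𝓐 be bounded continuous maps. Suppose there is g ∈ L¹(ℝⁿ), g ≥ 0, such that ‖A(x₁)B(x₂) − B(x₂)A(x₁)‖ ≤ g(x₂ − x₁) for all x₁, x₂ ∈ ℝⁿ. Let f : ℝⁿ → ℝ be continuous with compact support, let γ_A, γ_B ∈ ℝ satisfy γ_A + γ_B > n, and for R > 0 define the Bochner integrals A_R = R^{−γ_A} ∫_{ℝⁿ} f(x/R) • A(x) dx and B_R = R^{−γ_B} ∫_{ℝⁿ} f(x/R) • B(x) dx. Then lim_{R→∞} ‖A_R B_R − B_R A_R‖ = 0. -/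
open MeasureTheory Filter

section ContinuousBiadditive

variable {𝓐 : Type*} [NormedRing 𝓐] [NormedSpace ℝ 𝓐]

/-- Left multiplication in a normed ring is automatically real-linear, being additive and
continuous. -/
noncomputable def mulLeftRealCLM (a : 𝓐) : 𝓐 →L[ℝ] 𝓐 :=
  (AddMonoidHom.mulLeft a).toRealLinearMap (continuous_const_mul a)

/-- Right multiplication in a normed ring is automatically real-linear, being additive and
continuous. -/
noncomputable def mulRightRealCLM (a : 𝓐) : 𝓐 →L[ℝ] 𝓐 :=
  (AddMonoidHom.mulRight a).toRealLinearMap (continuous_mul_const a)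

theorem mul_real_smul (r : ℝ) (a b : 𝓐) : a * (r • b) = r • (a * b) :=
  (mulLeftRealCLM a).map_smul r b

theorem real_smul_mul (r : ℝ) (a b : 𝓐) : (r • a) * b = r • (a * b) :=
  (mulRightRealCLM b).map_smul r a

/-- The commutator with real scalars pulled out. -/
theorem real_smul_commutator (r s : ℝ) (a b : 𝓐) :
    (r • a) * (s • b) - (s • b) * (r • a) = (r * s) • (a * b - b * a) := by
  simp only [mul_real_smul, real_smul_mul, smul_sub, mul_smul, smul_comm s r]

variable [CompleteSpace 𝓐] {X Y : Type*} [MeasurableSpace X] [MeasurableSpace Y]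
  {μ : Measure X} {ν : Measure Y}

theorem integral_commutator_left {F : X → 𝓐} (hF : Integrable F μ) (b : 𝓐) :
    (∫ x, F x ∂μ) * b - b * (∫ x, F x ∂μ) = ∫ x, (F x * b - b * F x) ∂μ :=
  ((mulRightRealCLM b - mulLeftRealCLM b).integral_comp_comm hF).symm

theorem integral_commutator_right {G : Y → 𝓐} (hG : Integrable G ν) (a : 𝓐) :
    a * (∫ y, G y ∂ν) - (∫ y, G y ∂ν) * a = ∫ y, (a * G y - G y * a) ∂ν :=
  ((mulLeftRealCLM a - mulRightRealCLM a).integral_comp_comm hG).symm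

/-- A bound on the commutator of two integrals by an iterated integral bound on the
pointwise commutators. -/
theorem norm_commutator_integral_le {F : X → 𝓐} {G : Y → 𝓐}
    (hF : Integrable F μ) (hG : Integrable G ν) {k : X → Y → ℝ} {b : X → ℝ}
    (hk : ∀ x, Integrable (k x) ν) (hb : Integrable b μ)
    (hFG : ∀ x y, ‖F x * G y - G y * F x‖ ≤ k x y) (hkb : ∀ x, ∫ y, k x y ∂ν ≤ b x) :
    ‖(∫ x, F x ∂μ) * (∫ y, G y ∂ν) - (∫ y, G y ∂ν) * (∫ x, F x ∂μ)‖ ≤ ∫ x, b x ∂μ := by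
  rw [integral_commutator_left hF]
  refine norm_integral_le_of_norm_le hb (.of_forall fun x => ?_)
  rw [integral_commutator_right hG]
  exact (norm_integral_le_of_norm_le (hk x) (.of_forall (hFG x))).trans (hkb x)

end ContinuousBiadditive

/-- Section 3.3 (integrable-commutator version): if the commutator norms are
dominated by an integrable function of the difference variable and the scaling
exponents satisfy `γ_A + γ_B > n`, then the commutators of the block-averaged
observables vanish in the scaling limit. -/
theorem statement5 {𝓐 : Type*} [NormedRing 𝓐] [NormedSpace ℝ 𝓐] [CompleteSpace 𝓐]
    (n : ℕ) (hn : 1 ≤ n)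
    (A B : EuclideanSpace ℝ (Fin n) → 𝓐) (hA : Continuous A) (hB : Continuous B)
    (hAbdd : ∃ C, ∀ x, ‖A x‖ ≤ C) (hBbdd : ∃ C, ∀ x, ‖B x‖ ≤ C)
    (g : EuclideanSpace ℝ (Fin n) → ℝ) (hg : Integrable g) (hg0 : ∀ x, 0 ≤ g x)
    (hcomm : ∀ x₁ x₂, ‖A x₁ * B x₂ - B x₂ * A x₁‖ ≤ g (x₂ - x₁))
    (f : EuclideanSpace ℝ (Fin n) → ℝ) (hf : Continuous f)
    (hfsupp : HasCompactSupport f)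
    (γA γB : ℝ) (hγ : (n : ℝ) < γA + γB) :
    Tendsto (fun R : ℝ =>
        ‖(R ^ (-γA) • ∫ x, f (R⁻¹ • x) • A x) * (R ^ (-γB) • ∫ x, f (R⁻¹ • x) • B x) -
          (R ^ (-γB) • ∫ x, f (R⁻¹ • x) • B x) * (R ^ (-γA) • ∫ x, f (R⁻¹ • x) • A x)‖)
      atTop (nhds 0) := by
  obtain ⟨M, hM⟩ := hf.bounded_above_of_compact_support hfsupp
  have hbound : ∀ R : ℝ, 0 < R →
      ‖(R ^ (-γA) • ∫ x, f (R⁻¹ • x) • A x) * (R ^ (-γB) • ∫ x, f (R⁻¹ • x) • B x) -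
          (R ^ (-γB) • ∫ x, f (R⁻¹ • x) • B x) * (R ^ (-γA) • ∫ x, f (R⁻¹ • x) • A x)‖ ≤
        R ^ (-(γA + γB - n)) * ((∫ x, ‖f x‖) * (M * ∫ x, g x)) := by
    intro R hR
    have hc : Continuous fun x : EuclideanSpace ℝ (Fin n) => f (R⁻¹ • x) := by fun_prop
    have hs : HasCompactSupport fun x : EuclideanSpace ℝ (Fin n) => f (R⁻¹ • x) :=
      hfsupp.comp_smul (inv_ne_zero hR.ne')
    have hfR : Integrable fun x : EuclideanSpace ℝ (Fin n) => f (R⁻¹ • x) :=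
      hc.integrable_of_hasCompactSupport hs
    have hFA : Integrable fun x => f (R⁻¹ • x) • A x :=
      (hc.smul hA).integrable_of_hasCompactSupport hs.smul_right
    have hFB : Integrable fun x => f (R⁻¹ • x) • B x :=
      (hc.smul hB).integrable_of_hasCompactSupport hs.smul_right
    have hint : ‖(∫ x, f (R⁻¹ • x) • A x) * (∫ x, f (R⁻¹ • x) • B x) -
        (∫ x, f (R⁻¹ • x) • B x) * (∫ x, f (R⁻¹ • x) • A x)‖ ≤
        ∫ x, ‖f (R⁻¹ • x)‖ * (M * ∫ y, g y) := by
      refine norm_commutator_integral_le hFA hFB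
        (k := fun x y => ‖f (R⁻¹ • x)‖ * (M * g (y - x)))
        (fun x => ((hg.comp_sub_right x).const_mul M).const_mul _)
        (hfR.norm.mul_const _) (fun x y => ?_) (fun x => ?_)
      · rw [real_smul_commutator, norm_smul, norm_mul, mul_assoc]
        gcongr
        · exact (norm_nonneg _).trans (hM 0)
        · exact hM _
        · exact hcomm x y
      · rw [integral_const_mul, integral_const_mul, integral_sub_right_eq_self g x]
    rw [integral_mul_const,
      Measure.integral_comp_inv_smul volume (fun x : EuclideanSpace ℝ (Fin n) => ‖f x‖) R,
      finrank_euclideanSpace_fin, abs_of_pos (pow_pos hR n), smul_eq_mul] at hint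
    have hpow : R ^ (-(γA + γB - n)) = R ^ (-γA) * R ^ (-γB) * R ^ n := by
      rw [← Real.rpow_natCast, ← Real.rpow_add hR, ← Real.rpow_add hR]
      ring_nf
    rw [real_smul_commutator, norm_smul, Real.norm_of_nonneg (by positivity), hpow]
    calc _ ≤ R ^ (-γA) * R ^ (-γB) * (R ^ n * (∫ x, ‖f x‖) * (M * ∫ x, g x)) := by gcongr
      _ = _ := by ring
  have hlim : Tendsto (fun R : ℝ => R ^ (-(γA + γB - n)) * ((∫ x, ‖f x‖) * (M * ∫ x, g x)))
      atTop (nhds 0) := by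
    simpa using (tendsto_rpow_neg_atTop (sub_pos.2 hγ)).mul_const
      ((∫ x, ‖f x‖) * (M * ∫ x, g x))
  exact squeeze_zero' (.of_forall fun _ => norm_nonneg _)
    ((eventually_gt_atTop 0).mono hbound) hlim
end

section
/- Let 𝓐 be a (complex or real) Banach algebra, n ≥ 1, and let A, B : ℝⁿ → 𝓐 be bounded continuous maps. Suppose there are constants M ≥ 0 and D > 0 such that ‖A(x₁)B(x₂) − B(x₂)A(x₁)‖ ≤ M for all x₁, x₂, and A(x₁)B(x₂) = B(x₂)A(x₁) whenever |x₂ − x₁| ≥ D. Let f : ℝⁿ → ℝ be continuous with compact support, let γ_A, γ_B ∈ ℝ satisfy γ_A + γ_B > n, and for R > 0 define the Bochner integrals A_R = R^{−γ_A} ∫_{ℝⁿ} f(x/R) • A(x) dx and B_R = R^{−γ_B} ∫_{ℝⁿ} f(x/R) • B(x) dx. Then lim_{R→∞} ‖A_R B_R − B_R A_R‖ = 0. -/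
open MeasureTheory Filter

/-- In a normed ring that is a real normed space, left multiplication is additive and continuous,
hence real-linear. -/
theorem smulCommClass_real_of_normedRing (𝓐 : Type*) [NormedRing 𝓐] [NormedSpace ℝ 𝓐] :
    SMulCommClass ℝ 𝓐 𝓐 :=
  ⟨fun r a b => (map_real_smul (AddMonoidHom.mulLeft a) (continuous_const_mul a) r b).symm⟩

/-- In a normed ring that is a real normed space, right multiplication is additive and continuous,
hence real-linear. -/
theorem isScalarTower_real_of_normedRing (𝓐 : Type*) [NormedRing 𝓐] [NormedSpace ℝ 𝓐] :
    IsScalarTower ℝ 𝓐 𝓐 :=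
  ⟨fun r a b => map_real_smul (AddMonoidHom.mulRight b) (continuous_mul_const b) r a⟩

/-- The commutator of two integrals is the iterated integral of the commutators. -/
theorem integral_commutator {X 𝓐 : Type*} [MeasurableSpace X] {μ : Measure X}
    [NormedRing 𝓐] [NormedSpace ℝ 𝓐] [SMulCommClass ℝ 𝓐 𝓐] [IsScalarTower ℝ 𝓐 𝓐]
    {F G : X → 𝓐} (hF : Integrable F μ) (hG : Integrable G μ) :
    (∫ x, F x ∂μ) * (∫ y, G y ∂μ) - (∫ y, G y ∂μ) * (∫ x, F x ∂μ) =
      ∫ x, ∫ y, (F x * G y - G y * F x) ∂μ ∂μ := by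
  have hinner (x : X) : ∫ y, (F x * G y - G y * F x) ∂μ =
      F x * (∫ y, G y ∂μ) - (∫ y, G y ∂μ) * F x := by
    rw [integral_sub (hG.const_mul _) (hG.mul_const _), integral_const_mul_of_integrable hG,
      integral_mul_const_of_integrable hG]
  simp_rw [hinner]
  rw [integral_sub (hF.mul_const _) (hF.const_mul _), integral_const_mul_of_integrable hF,
    integral_mul_const_of_integrable hF]

/-- If the commutators `[A x, B y]` are bounded by `M` and vanish at distance at least `D`, the
commutator of the integrals of `g • A` and `g • B` is controlled by the `L¹` norm of `g`. -/
theorem norm_commutator_integral_smul_le {E 𝓐 : Type*} [NormedAddCommGroup E] [NormedSpace ℝ E]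
    [FiniteDimensional ℝ E] [MeasurableSpace E] [BorelSpace E] (μ : Measure E) [μ.IsAddHaarMeasure]
    [NormedRing 𝓐] [NormedSpace ℝ 𝓐] [SMulCommClass ℝ 𝓐 𝓐] [IsScalarTower ℝ 𝓐 𝓐]
    {A B : E → 𝓐} {g : E → ℝ} {M D K : ℝ} (hg : Integrable g μ)
    (hgK : ∀ y, ‖g y‖ ≤ K) (hgA : Integrable (fun x => g x • A x) μ)
    (hgB : Integrable (fun x => g x • B x) μ)
    (hcommbdd : ∀ x y, ‖A x * B y - B y * A x‖ ≤ M)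
    (hlocal : ∀ x y, D ≤ ‖y - x‖ → A x * B y = B y * A x) :
    ‖(∫ x, g x • A x ∂μ) * (∫ x, g x • B x ∂μ) - (∫ x, g x • B x ∂μ) * (∫ x, g x • A x ∂μ)‖ ≤
      (∫ x, ‖g x‖ ∂μ) * (K * M * μ.real (Metric.ball 0 D)) := by
  rw [integral_commutator hgA hgB, ← integral_mul_const]
  refine norm_integral_le_of_norm_le (hg.norm.mul_const _) (ae_of_all _ fun x => ?_)
  have hball : μ.real (Metric.ball x D) = μ.real (Metric.ball 0 D) := by
    simp only [Measure.real, Measure.addHaar_ball_center μ x D]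
  have hint : ∫ y, (Metric.ball x D).indicator (fun _ => ‖g x‖ * (K * M)) y ∂μ =
      ‖g x‖ * (K * M * μ.real (Metric.ball 0 D)) := by
    rw [integral_indicator_const _ measurableSet_ball, hball, smul_eq_mul]
    ring
  rw [← hint]
  refine norm_integral_le_of_norm_le
    ((integrable_indicator_iff measurableSet_ball).2
      (integrableOn_const measure_ball_lt_top.ne)) (ae_of_all _ fun y => ?_)
  have hcomm : g x • A x * g y • B y - g y • B y * g x • A x =
      g x • g y • (A x * B y - B y * A x) := by
    simp only [smul_mul_assoc, mul_smul_comm, smul_sub]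
    rw [smul_comm (g y) (g x) (A x * B y)]
  rw [hcomm]
  by_cases hy : y ∈ Metric.ball x D
  · rw [Set.indicator_of_mem hy, norm_smul, norm_smul]
    have hK : 0 ≤ K := (norm_nonneg _).trans (hgK y)
    gcongr
    exacts [hgK y, hcommbdd x y]
  · rw [Set.indicator_of_notMem hy, hlocal x y (by simpa [dist_eq_norm] using hy)]
    simp

/-- Section 3.3 (strictly local version): if the commutators are uniformly
bounded in norm and vanish whenever the separation is at least `D`, and the
scaling exponents satisfy `γ_A + γ_B > n`, then the commutators of the
block-averaged observables vanish in the scaling limit. -/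
theorem statement6 {𝓐 : Type*} [NormedRing 𝓐] [NormedSpace ℝ 𝓐] [CompleteSpace 𝓐]
    (n : ℕ) (hn : 1 ≤ n)
    (A B : EuclideanSpace ℝ (Fin n) → 𝓐) (hA : Continuous A) (hB : Continuous B)
    (hAbdd : ∃ C, ∀ x, ‖A x‖ ≤ C) (hBbdd : ∃ C, ∀ x, ‖B x‖ ≤ C)
    (M : ℝ) (hM : 0 ≤ M) (D : ℝ) (hD : 0 < D)
    (hcommbdd : ∀ x₁ x₂, ‖A x₁ * B x₂ - B x₂ * A x₁‖ ≤ M)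
    (hlocal : ∀ x₁ x₂, D ≤ ‖x₂ - x₁‖ → A x₁ * B x₂ = B x₂ * A x₁)
    (f : EuclideanSpace ℝ (Fin n) → ℝ) (hf : Continuous f)
    (hfsupp : HasCompactSupport f)
    (γA γB : ℝ) (hγ : (n : ℝ) < γA + γB) :
    Tendsto (fun R : ℝ =>
        ‖(R ^ (-γA) • ∫ x, f (R⁻¹ • x) • A x) * (R ^ (-γB) • ∫ x, f (R⁻¹ • x) • B x) -
          (R ^ (-γB) • ∫ x, f (R⁻¹ • x) • B x) * (R ^ (-γA) • ∫ x, f (R⁻¹ • x) • A x)‖)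
      atTop (nhds 0) := by
  have := smulCommClass_real_of_normedRing 𝓐
  have := isScalarTower_real_of_normedRing 𝓐
  obtain ⟨K, hK⟩ := hf.bounded_above_of_compact_support hfsupp
  set L : ℝ := (∫ x, ‖f x‖) * (K * M * volume.real (Metric.ball (0 : EuclideanSpace ℝ (Fin n)) D))
  have hlim : Tendsto (fun R : ℝ => R ^ (-(γA + γB - n)) * L) atTop (nhds 0) := by
    simpa using (tendsto_rpow_neg_atTop (sub_pos.2 hγ)).mul_const L
  refine squeeze_zero' (Eventually.of_forall fun _ => norm_nonneg _) ?_ hlim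
  filter_upwards [eventually_gt_atTop 0] with R hR
  have hcont : Continuous fun x => f (R⁻¹ • x) := hf.comp (continuous_const_smul _)
  have hsupp : HasCompactSupport fun x => f (R⁻¹ • x) :=
    hfsupp.comp_smul (inv_ne_zero hR.ne')
  have hbound := norm_commutator_integral_smul_le volume
    (hcont.integrable_of_hasCompactSupport hsupp) (fun y => hK (R⁻¹ • y))
    ((hcont.smul hA).integrable_of_hasCompactSupport hsupp.smul_right)
    ((hcont.smul hB).integrable_of_hasCompactSupport hsupp.smul_right) hcommbdd hlocal
  rw [Measure.integral_comp_inv_smul volume (fun x => ‖f x‖) R, finrank_euclideanSpace_fin,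
    smul_eq_mul, abs_of_nonneg (by positivity), mul_assoc] at hbound
  have hpow : R ^ (-(γA + γB - n)) = R ^ (-γA) * R ^ (-γB) * R ^ n := by
    rw [← Real.rpow_natCast, ← Real.rpow_add hR, ← Real.rpow_add hR]
    ring_nf
  rw [smul_mul_smul_comm, smul_mul_smul_comm, mul_comm (R ^ (-γB)), ← smul_sub, norm_smul,
    Real.norm_of_nonneg (by positivity), hpow, mul_assoc (R ^ (-γA) * R ^ (-γB))]
  gcongr
end

section
/- Let n ≥ 1 and α > 0, and let W : ℝⁿ → ℝ be measurable such that G(y) := W(y)·(1+|y|²)^{−α/2} belongs to L¹(ℝⁿ). Let f : ℝⁿ → ℝ be continuous with compact support and let Y ∈ ℝⁿ be such that y + Y ≠ 0 for every y in the support of the autocorrelation f⋆f, where (f⋆f)(y) = ∫ f(y+x)f(x)dx. Then lim_{R→∞} R^{−(n+α)} ∫_{ℝⁿ×ℝⁿ} W((x₁−x₂)+RY) f(x₁/R) f(x₂/R) dx₁dx₂ = 0. -/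
open MeasureTheory Filter

/-- On a ball of radius proportional to `R`, removing the weight costs a factor of order `R ^ α`. -/
lemma norm_le_weighted {E : Type*} [NormedAddCommGroup E] {α C : ℝ} {W : E → ℝ} (hα : 0 < α)
    {R : ℝ} (hR : 1 ≤ R) {z : E} (hz : ‖z‖ ≤ C * R) :
    ‖W z‖ ≤ R ^ α * ((1 + C ^ 2) ^ (α / 2) * ‖W z * (1 + ‖z‖ ^ 2) ^ (-α / 2)‖) := by
  have hR0 : 0 < R := by linarith
  have hz0 : 0 < 1 + ‖z‖ ^ 2 := by positivity
  have hle : (1 + ‖z‖ ^ 2) ^ (α / 2) ≤ R ^ α * (1 + C ^ 2) ^ (α / 2) := by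
    have hRα : R ^ α = (R ^ 2) ^ (α / 2) := by
      rw [← Real.rpow_natCast, ← Real.rpow_mul hR0.le]
      congr 1
      push_cast
      ring
    rw [hRα, ← Real.mul_rpow (by positivity) (by positivity)]
    refine Real.rpow_le_rpow hz0.le ?_ (by positivity)
    have : ‖z‖ ^ 2 ≤ (C * R) ^ 2 := by gcongr
    nlinarith
  have hinv : (1 + ‖z‖ ^ 2) ^ (α / 2) * (1 + ‖z‖ ^ 2) ^ (-α / 2) = 1 := by
    rw [← Real.rpow_add hz0, show α / 2 + -α / 2 = 0 by ring, Real.rpow_zero]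
  have hw : 0 < (1 + ‖z‖ ^ 2) ^ (-α / 2) := Real.rpow_pos_of_pos hz0 _
  rw [norm_mul, Real.norm_of_nonneg hw.le]
  calc ‖W z‖ = (1 + ‖z‖ ^ 2) ^ (α / 2) * (‖W z‖ * (1 + ‖z‖ ^ 2) ^ (-α / 2)) := by
        linear_combination (-‖W z‖) * hinv
    _ ≤ R ^ α * (1 + C ^ 2) ^ (α / 2) * (‖W z‖ * (1 + ‖z‖ ^ 2) ^ (-α / 2)) := by gcongr
    _ = _ := by ring

section Growth

variable {E : Type*} [NormedAddCommGroup E] [MeasurableSpace E] [BorelSpace E]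
  {μ : Measure E} {α C : ℝ} {W : E → ℝ}

lemma integrableOn_closedBall_of_weighted (hα : 0 < α) (hW : Measurable W)
    (hG : Integrable (fun y : E => W y * (1 + ‖y‖ ^ 2) ^ (-α / 2)) μ) {R : ℝ} (hR : 1 ≤ R) :
    IntegrableOn W (Metric.closedBall 0 (C * R)) μ := by
  refine Integrable.mono' ((hG.norm.const_mul ((1 + C ^ 2) ^ (α / 2))).const_mul
    (R ^ α)).integrableOn hW.aestronglyMeasurable ?_
  filter_upwards [ae_restrict_mem measurableSet_closedBall] with z hz
  exact norm_le_weighted hα hR (by simpa using hz)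

/-- If `W` is integrable against a weight of order `‖y‖ ^ (-α)`, then the mass of `W` on balls of
radius `C * R` is `o(R ^ α)`. -/
lemma tendsto_rpow_neg_mul_integral_closedBall (hα : 0 < α) (hW : Measurable W)
    (hG : Integrable (fun y : E => W y * (1 + ‖y‖ ^ 2) ^ (-α / 2)) μ) :
    Tendsto (fun R : ℝ => R ^ (-α) * ∫ z in Metric.closedBall 0 (C * R), ‖W z‖ ∂μ)
      atTop (nhds 0) := by
  have hlim : Tendsto (fun R : ℝ => ∫ z, (Metric.closedBall 0 (C * R)).indicator
      (fun z => R ^ (-α) * ‖W z‖) z ∂μ) atTop (nhds (∫ _, (0 : ℝ) ∂μ)) := by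
    refine tendsto_integral_filter_of_dominated_convergence
      (fun z => (1 + C ^ 2) ^ (α / 2) * ‖W z * (1 + ‖z‖ ^ 2) ^ (-α / 2)‖) ?_ ?_
      (hG.norm.const_mul _) ?_
    · exact Eventually.of_forall fun R => ((hW.norm.const_mul _).indicator
        measurableSet_closedBall).aestronglyMeasurable
    · filter_upwards [eventually_ge_atTop 1] with R hR
      refine Eventually.of_forall fun z => ?_
      have hRα : 0 < R ^ α := Real.rpow_pos_of_pos (by linarith) _
      by_cases hz : z ∈ Metric.closedBall (0 : E) (C * R)
      · rw [Set.indicator_of_mem hz, Real.rpow_neg (by linarith), norm_mul, norm_norm,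
          Real.norm_of_nonneg (inv_nonneg.2 hRα.le), inv_mul_le_iff₀ hRα]
        exact norm_le_weighted hα hR (by simpa using hz)
      · rw [Set.indicator_of_notMem hz, norm_zero]
        positivity
    · refine Eventually.of_forall fun z => ?_
      have h0 : Tendsto (fun R : ℝ => R ^ (-α) * ‖W z‖) atTop (nhds 0) := by
        simpa using (tendsto_rpow_neg_atTop hα).mul_const ‖W z‖
      refine squeeze_zero_norm' ?_ h0
      filter_upwards [eventually_ge_atTop 0] with R hR
      have := Real.rpow_nonneg hR (-α)
      refine (norm_indicator_le_norm_self _ _).trans_eq ?_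
      exact Real.norm_of_nonneg (by positivity)
  rw [integral_zero] at hlim
  refine hlim.congr fun R => ?_
  rw [integral_indicator measurableSet_closedBall, integral_const_mul]

end Growth

section Smearing

variable {E : Type*} [NormedAddCommGroup E] [NormedSpace ℝ E] [FiniteDimensional ℝ E]
  [MeasurableSpace E] [BorelSpace E] {μ : Measure E} [μ.IsAddHaarMeasure]

/-- A smeared two-point function is bounded by the mass of `W` on a ball containing all differences
of points of the scaled supports. -/
lemma norm_integral_smeared_le {W f : E → ℝ} (hW : Measurable W) {M B : ℝ}
    (hM : ∀ x, ‖f x‖ ≤ M) (hB : ∀ x, f x ≠ 0 → ‖x‖ ≤ B) (Y : E) {R : ℝ} (hR : 0 < R)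
    (hint : IntegrableOn W (Metric.closedBall 0 ((B + B + ‖Y‖) * R)) μ) :
    ‖∫ p : E × E, W (p.1 - p.2 + R • Y) * f (R⁻¹ • p.1) * f (R⁻¹ • p.2) ∂(μ.prod μ)‖ ≤
      M ^ 2 * μ.real (Metric.closedBall 0 (B * R)) *
        ∫ z in Metric.closedBall 0 ((B + B + ‖Y‖) * R), ‖W z‖ ∂μ := by
  have hM0 : 0 ≤ M := (norm_nonneg _).trans (hM 0)
  set S : Set E := Metric.closedBall 0 (B * R)
  set T : Set E := Metric.closedBall 0 ((B + B + ‖Y‖) * R)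
  have hS : MeasurableSet S := measurableSet_closedBall
  have hT : MeasurableSet T := measurableSet_closedBall
  have hg : Measurable (T.indicator fun z => ‖W z‖ₑ) := hW.enorm.indicator hT
  have hsupp : ∀ x, f (R⁻¹ • x) ≠ 0 → ‖x‖ ≤ B * R := fun x hx => by
    have := hB _ hx
    rwa [norm_smul, norm_inv, Real.norm_of_nonneg hR.le, inv_mul_le_iff₀ hR, mul_comm] at this
  have hpt : ∀ p : E × E, ‖W (p.1 - p.2 + R • Y) * f (R⁻¹ • p.1) * f (R⁻¹ • p.2)‖ₑ ≤
      S.indicator (fun _ => ENNReal.ofReal (M ^ 2)) p.2 *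
        T.indicator (fun z => ‖W z‖ₑ) (p.1 - p.2 + R • Y) := by
    rintro ⟨x, y⟩
    by_cases hx : f (R⁻¹ • x) = 0
    · simp [hx]
    by_cases hy : f (R⁻¹ • y) = 0
    · simp [hy]
    have hyS : y ∈ S := by simpa [S] using hsupp y hy
    have hxyT : x - y + R • Y ∈ T := by
      have h1 := norm_add_le (x - y) (R • Y)
      have h2 := norm_sub_le x y
      have h3 : ‖R • Y‖ = R * ‖Y‖ := by rw [norm_smul, Real.norm_of_nonneg hR.le]
      have h4 := hsupp x hx
      have h5 := hsupp y hy
      rw [mem_closedBall_zero_iff]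
      linarith
    simp only [Set.indicator_of_mem hyS, Set.indicator_of_mem hxyT]
    rw [← ofReal_norm, ← ofReal_norm, ← ENNReal.ofReal_mul (by positivity)]
    refine ENNReal.ofReal_le_ofReal ?_
    rw [norm_mul, norm_mul]
    calc ‖W (x - y + R • Y)‖ * ‖f (R⁻¹ • x)‖ * ‖f (R⁻¹ • y)‖
        ≤ ‖W (x - y + R • Y)‖ * M * M := by gcongr <;> exact hM _
      _ = _ := by ring
  have hlint : ∫⁻ p : E × E, S.indicator (fun _ => ENNReal.ofReal (M ^ 2)) p.2 *
      T.indicator (fun z => ‖W z‖ₑ) (p.1 - p.2 + R • Y) ∂(μ.prod μ) =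
      ENNReal.ofReal (M ^ 2) * μ S * ∫⁻ z in T, ‖W z‖ₑ ∂μ := by
    have hmeas : Measurable fun p : E × E => S.indicator (fun _ => ENNReal.ofReal (M ^ 2)) p.2 *
        T.indicator (fun z => ‖W z‖ₑ) (p.1 - p.2 + R • Y) :=
      ((measurable_const.indicator hS).comp measurable_snd).mul (hg.comp (by fun_prop))
    rw [lintegral_prod_symm' _ hmeas]
    have hinner : ∀ y : E, ∫⁻ x, S.indicator (fun _ => ENNReal.ofReal (M ^ 2)) y *
        T.indicator (fun z => ‖W z‖ₑ) (x - y + R • Y) ∂μ =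
        S.indicator (fun _ => ENNReal.ofReal (M ^ 2)) y * ∫⁻ z in T, ‖W z‖ₑ ∂μ := fun y => by
      have hgy : Measurable fun x => T.indicator (fun z => ‖W z‖ₑ) (x - y + R • Y) :=
        hg.comp (by fun_prop)
      rw [lintegral_const_mul _ hgy]
      simp_rw [sub_add_eq_add_sub, add_sub_assoc]
      rw [lintegral_add_right_eq_self (T.indicator fun z => ‖W z‖ₑ), lintegral_indicator hT]
    simp_rw [hinner]
    rw [lintegral_mul_const _ (measurable_const.indicator hS), lintegral_indicator_const hS]
  have hbound := ((enorm_integral_le_lintegral_enorm _).trans (lintegral_mono hpt)).trans_eq hlint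
  have hSfin : μ S ≠ ⊤ := measure_closedBall_lt_top.ne
  rw [← ofReal_norm, ← ofReal_integral_norm_eq_lintegral_enorm hint,
    ← ofReal_measureReal hSfin, ← ENNReal.ofReal_mul (by positivity),
    ← ENNReal.ofReal_mul (by positivity)] at hbound
  exact (ENNReal.ofReal_le_ofReal_iff (by positivity)).1 hbound

end Smearing

/-- Conclusion of Method Two (Section 4.2): if `α` is chosen so large that
`G(y) = W(y)·(1+|y|²)^{-α/2}` is integrable, then with scaling prefactor
`R^{-2γ} = R^{-(n+α)}` the renormalised two-point function vanishes in the
scaling limit (assuming `y + Y ≠ 0` on the support of `f⋆f`). -/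
theorem statement8 (n : ℕ) (hn : 1 ≤ n) (α : ℝ) (hα : 0 < α)
    (W : EuclideanSpace ℝ (Fin n) → ℝ) (hWmeas : Measurable W)
    (hG : Integrable (fun y : EuclideanSpace ℝ (Fin n) =>
      W y * (1 + ‖y‖ ^ 2) ^ (-α / 2)))
    (f : EuclideanSpace ℝ (Fin n) → ℝ) (hf : Continuous f)
    (hfsupp : HasCompactSupport f)
    (Y : EuclideanSpace ℝ (Fin n))
    (hY : ∀ y ∈ tsupport (fun y => ∫ x, f (y + x) * f x), y + Y ≠ 0) :
    Tendsto (fun R : ℝ =>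
        R ^ (-((n : ℝ) + α)) *
          ∫ p : EuclideanSpace ℝ (Fin n) × EuclideanSpace ℝ (Fin n),
            W (p.1 - p.2 + R • Y) * f (R⁻¹ • p.1) * f (R⁻¹ • p.2))
      atTop (nhds 0) := by
  obtain ⟨M, hM⟩ := hf.bounded_above_of_compact_support hfsupp
  obtain ⟨B, hB⟩ := hfsupp.isBounded.exists_norm_le
  have hB' : ∀ x, f x ≠ 0 → ‖x‖ ≤ B := fun x hx => hB x (subset_tsupport f hx)
  set V := (volume : Measure (EuclideanSpace ℝ (Fin n))).real (Metric.closedBall 0 B)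
  have hlim := (tendsto_rpow_neg_mul_integral_closedBall (C := B + B + ‖Y‖) hα hWmeas hG).const_mul
    (M ^ 2 * V)
  rw [mul_zero] at hlim
  refine squeeze_zero_norm' ?_ hlim
  filter_upwards [eventually_ge_atTop 1] with R hR
  have hR0 : 0 < R := by linarith
  have hvol : volume.real (Metric.closedBall (0 : EuclideanSpace ℝ (Fin n)) (B * R)) =
      R ^ n * V := by
    rw [mul_comm B, measureReal_def, Measure.addHaar_closedBall_mul_of_pos _ _ hR0,
      finrank_euclideanSpace_fin, ENNReal.toReal_mul, ENNReal.toReal_ofReal (by positivity)]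
    rfl
  have hle := norm_integral_smeared_le hWmeas hM hB' Y hR0
    (integrableOn_closedBall_of_weighted hα hWmeas hG hR)
  rw [hvol] at hle
  have hpow : R ^ (-((n : ℝ) + α)) * R ^ n = R ^ (-α) := by
    rw [← Real.rpow_natCast, ← Real.rpow_add hR0]
    congr 1
    ring
  have hpos : 0 < R ^ (-((n : ℝ) + α)) := Real.rpow_pos_of_pos hR0 _
  rw [norm_mul, Real.norm_of_nonneg hpos.le, ← hpow]
  exact (mul_le_mul_of_nonneg_left hle hpos.le).trans_eq (by ring)
end

section
/- Let n ≥ 1 and l ≥ 2 be integers and set m = (l−1)n. Let H : ℝ^m → ℝ be continuous with H(y) > 0 for y ≠ 0 and positively homogeneous of degree α′ > 0, i.e. H(λy) = λ^{α′} H(y) for all λ > 0 and y ∈ ℝ^m. Let c ∈ ℝ and let F : ℝ^m → ℝ be bounded measurable with F(y) → 0 as |y| → ∞, and set W(y) = (c + F(y)) / (1 + H(y)). Let f : ℝⁿ → ℝ be continuous with compact support, and let X₁, …, X_l ∈ ℝⁿ be such that for all x₁, …, x_l in the support of f the vector ((x₁−x₂)+(X₁−X₂), …, (x_{l−1}−x_l)+(X_{l−1}−X_l))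 ∈ ℝ^m is nonzero. Set γ = n − α′/l. Then lim_{R→∞} R^{−lγ} ∫_{(ℝⁿ)^l} W(x₁−x₂+R(X₁−X₂), …, x_{l−1}−x_l+R(X_{l−1}−X_l)) · ∏_{i=1}^{l} f(x_i/R) dx₁⋯dx_l = c · ∫_{(ℝⁿ)^l} H((x₁−x₂)+(X₁−X₂), …, (x_{l−1}−x_l)+(X_{l−1}−X_l))^{−1} · ∏_{i=1}^{l} f(x_i) dx₁⋯dx_l. -/
open MeasureTheory Filter

/-- A pointwise limit times a finite product of compactly supported factors passes to the integral
when the convergence is bounded on the product of the supports. -/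
theorem tendsto_integral_mul_prod_of_bound {ι E : Type*} [Fintype ι] [NormedAddCommGroup E]
    [MeasurableSpace E] [BorelSpace E] [SecondCountableTopology E] {μ : Measure E} [SigmaFinite μ]
    [IsFiniteMeasureOnCompacts μ] {f : E → ℝ} (hf : Continuous f) (hfsupp : HasCompactSupport f)
    {l : Filter ℝ} [l.IsCountablyGenerated] {G : ℝ → (ι → E) → ℝ} {g : (ι → E) → ℝ} {B : ℝ}
    (hG : ∀ᶠ R in l, Measurable (G R))
    (hB : ∀ᶠ R in l, ∀ x, (∀ i, x i ∈ tsupport f) → |G R x| ≤ B)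
    (hlim : ∀ x, (∀ i, x i ∈ tsupport f) → Tendsto (fun R => G R x) l (nhds (g x))) :
    Tendsto (fun R => ∫ x, G R x * ∏ i, f (x i) ∂Measure.pi fun _ : ι => μ) l
      (nhds (∫ x, g x * ∏ i, f (x i) ∂Measure.pi fun _ : ι => μ)) := by
  have hprod : Integrable (fun x : ι → E => ∏ i, f (x i)) (Measure.pi fun _ : ι => μ) :=
    Integrable.fintype_prod fun _ => hf.integrable_of_hasCompactSupport hfsupp
  have hzero : ∀ x : ι → E, (¬ ∀ i, x i ∈ tsupport f) → ∏ i, f (x i) = 0 := by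
    intro x hx
    push Not at hx
    obtain ⟨i, hi⟩ := hx
    exact Finset.prod_eq_zero (Finset.mem_univ i) (image_eq_zero_of_notMem_tsupport hi)
  refine tendsto_integral_filter_of_dominated_convergence
    (fun x => B * |∏ i, f (x i)|) ?_ ?_ (hprod.abs.const_mul B) ?_
  · filter_upwards [hG] with R hR
    exact hR.aestronglyMeasurable.mul hprod.aestronglyMeasurable
  · filter_upwards [hB] with R hR
    refine Eventually.of_forall fun x => ?_
    by_cases hx : ∀ i, x i ∈ tsupport f
    · rw [Real.norm_eq_abs, abs_mul]
      exact mul_le_mul_of_nonneg_right (hR x hx) (abs_nonneg _)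
    · simp [hzero x hx]
  · refine Eventually.of_forall fun x => ?_
    by_cases hx : ∀ i, x i ∈ tsupport f
    · exact (hlim x hx).mul_const _
    · simpa only [hzero x hx, mul_zero] using tendsto_const_nhds

/-- Renormalising `(c + F) / (1 + H)` along a ray recovers `c * H⁻¹`. -/
theorem tendsto_rpow_mul_div_one_add_homogeneous {E : Type*} [NormedAddCommGroup E]
    [NormedSpace ℝ E] {α c : ℝ} (hα : 0 < α) {H F : E → ℝ}
    (hHhom : ∀ lam : ℝ, 0 < lam → ∀ y, H (lam • y) = lam ^ α * H y)
    (hF : Tendsto F (cocompact E) (nhds 0)) [ProperSpace E] {y : E} (hy : y ≠ 0)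
    (hHy : 0 < H y) :
    Tendsto (fun R : ℝ => R ^ α * ((c + F (R • y)) / (1 + H (R • y)))) atTop
      (nhds (c * (H y)⁻¹)) := by
  have hray : Tendsto (fun R : ℝ => R • y) atTop (cocompact E) := by
    rw [← Metric.cobounded_eq_cocompact, ← comap_norm_atTop, tendsto_comap_iff]
    have h := (tendsto_abs_atTop_atTop (G := ℝ)).atTop_mul_const (norm_pos_iff.2 hy)
    exact h.congr fun R => by simp [norm_smul]
  have hinv : Tendsto (fun R : ℝ => (R ^ α)⁻¹ + H y) atTop (nhds (H y)) := by
    simpa using (tendsto_rpow_atTop hα).inv_tendsto_atTop.add_const (H y)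
  have hnum : Tendsto (fun R : ℝ => c + F (R • y)) atTop (nhds c) := by
    simpa using (hF.comp hray).const_add c
  rw [← div_eq_mul_inv]
  refine (hnum.div hinv hHy.ne').congr' ?_
  filter_upwards [eventually_gt_atTop 0] with R hR
  have hp : 0 < R ^ α := Real.rpow_pos_of_pos hR α
  have h1 : 0 < 1 + R ^ α * H y := by positivity
  rw [Pi.div_apply, hHhom R hR]
  field_simp

/-- Main result of Section 5: scaling limit of the critical truncated
`l`-point function, with `l = k + 1 ≥ 2` observables and `l - 1 = k`
difference variables.  With `(1 + H(y))·W(y) = c + F(y)`, `H` positive and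
homogeneous of degree `α' > 0`, `F` bounded and vanishing at infinity, and
the threshold exponent `γ = n - α'/l`, the renormalised truncated `l`-point
function of the block observables converges to
`c · ∫ H(y + Y)⁻¹ ∏ f(xᵢ) dx`, provided the shifted difference vector never
vanishes when all `xᵢ` lie in the support of `f`. -/
theorem statement10 (n k : ℕ) (hn : 1 ≤ n) (hk : 1 ≤ k)
    (α' : ℝ) (hα' : 0 < α')
    (H : (Fin k → EuclideanSpace ℝ (Fin n)) → ℝ) (hHcont : Continuous H)
    (hHpos : ∀ y, y ≠ 0 → 0 < H y)
    (hHhom : ∀ lam : ℝ, 0 < lam → ∀ y, H (lam • y) = lam ^ α' * H y)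
    (c : ℝ) (F : (Fin k → EuclideanSpace ℝ (Fin n)) → ℝ) (hFmeas : Measurable F)
    (hFbdd : ∃ C, ∀ y, |F y| ≤ C)
    (hFdecay : Tendsto F (cocompact ((Fin k → EuclideanSpace ℝ (Fin n)))) (nhds 0))
    (W : (Fin k → EuclideanSpace ℝ (Fin n)) → ℝ)
    (hW : ∀ y, W y = (c + F y) / (1 + H y))
    (f : EuclideanSpace ℝ (Fin n) → ℝ) (hf : Continuous f)
    (hfsupp : HasCompactSupport f)
    (X : Fin (k + 1) → EuclideanSpace ℝ (Fin n))
    (hX : ∀ x : Fin (k + 1) → EuclideanSpace ℝ (Fin n), (∀ i, x i ∈ tsupport f) →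
      (fun i : Fin k => (x i.castSucc - x i.succ) + (X i.castSucc - X i.succ)) ≠ 0)
    (γ : ℝ) (hγ : γ = (n : ℝ) - α' / (k + 1)) :
    Tendsto (fun R : ℝ =>
        R ^ (-(((k + 1 : ℕ) : ℝ) * γ)) *
          ∫ x : Fin (k + 1) → EuclideanSpace ℝ (Fin n),
            W (fun i => (x i.castSucc - x i.succ) + R • (X i.castSucc - X i.succ)) *
              ∏ i, f (R⁻¹ • x i))
      atTop
      (nhds (c * ∫ x : Fin (k + 1) → EuclideanSpace ℝ (Fin n),
          (H (fun i => (x i.castSucc - x i.succ) + (X i.castSucc - X i.succ)))⁻¹ *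
            ∏ i, f (x i))) := by
  obtain ⟨C, hC⟩ := hFbdd
  set Y : (Fin (k + 1) → EuclideanSpace ℝ (Fin n)) → Fin k → EuclideanSpace ℝ (Fin n) :=
    fun x i => (x i.castSucc - x i.succ) + (X i.castSucc - X i.succ) with hY
  have hYcont : Continuous Y := by fun_prop
  have hWmeas : Measurable W := by
    rw [show W = fun y => (c + F y) / (1 + H y) from funext hW]
    exact (hFmeas.const_add c).div (hHcont.measurable.const_add 1)
  obtain ⟨m, hm, hmH⟩ : ∃ m, 0 < m ∧ ∀ x, (∀ i, x i ∈ tsupport f) → m ≤ H (Y x) := by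
    have hK : IsCompact (Set.univ.pi fun _ : Fin (k + 1) => tsupport f) :=
      isCompact_univ_pi fun _ => hfsupp
    obtain ⟨m, hm, h⟩ := hK.exists_forall_le' (hHcont.comp hYcont).continuousOn (a := 0)
      fun x hx => hHpos _ (hX x fun i => hx i trivial)
    exact ⟨m, hm, fun x hx => h x fun i _ => hx i⟩
  have hlim := tendsto_integral_mul_prod_of_bound (ι := Fin (k + 1)) (μ := volume) hf hfsupp
    (l := atTop) (G := fun R x => R ^ α' * W (R • Y x)) (g := fun x => c * (H (Y x))⁻¹)
    (B := (|c| + C) / m)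
    (Eventually.of_forall fun R =>
      (hWmeas.comp (hYcont.const_smul R).measurable).const_mul _)
    (by
      filter_upwards [eventually_gt_atTop 0] with R hR x hx
      have hp : 0 < R ^ α' := Real.rpow_pos_of_pos hR α'
      have hHx := hmH x hx
      have hHx0 : 0 < H (Y x) := hm.trans_le hHx
      have hcF : |c + F (R • Y x)| ≤ |c| + C := (abs_add_le _ _).trans (by gcongr; exact hC _)
      have h1 : 0 < 1 + R ^ α' * H (Y x) := by positivity
      have hle : R ^ α' / (1 + R ^ α' * H (Y x)) ≤ m⁻¹ := by
        rw [div_le_iff₀ h1, ← div_eq_inv_mul, le_div_iff₀ hm]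
        nlinarith [mul_le_mul_of_nonneg_left hHx hp.le]
      calc |R ^ α' * W (R • Y x)|
          = |c + F (R • Y x)| * (R ^ α' / (1 + R ^ α' * H (Y x))) := by
            rw [hW, hHhom R hR, abs_mul, abs_div, abs_of_pos hp, abs_of_pos h1]
            ring
        _ ≤ (|c| + C) * m⁻¹ :=
            mul_le_mul hcF hle (by positivity) ((abs_nonneg _).trans hcF)
        _ = (|c| + C) / m := (div_eq_mul_inv _ _).symm)
    (fun x hx => by
      simp only [hW]
      exact tendsto_rpow_mul_div_one_add_homogeneous hα' hHhom hFdecay (hX x hx)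
        (hHpos _ (hX x hx)))
  simp only [mul_assoc, integral_const_mul] at hlim
  refine hlim.congr' ?_
  filter_upwards [eventually_gt_atTop 0] with R hR
  have hscale := Measure.integral_comp_smul_of_nonneg
    (volume : Measure (Fin (k + 1) → EuclideanSpace ℝ (Fin n)))
    (fun x => W (fun i => (x i.castSucc - x i.succ) + R • (X i.castSucc - X i.succ)) *
      ∏ i, f (R⁻¹ • x i)) R (hR := hR.le)
  have hleft : ∀ x : Fin (k + 1) → EuclideanSpace ℝ (Fin n),
      (fun i : Fin k => ((R • x) i.castSucc - (R • x) i.succ) +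
        R • (X i.castSucc - X i.succ)) = R • Y x := by
    intro x
    funext i
    simp [hY, smul_add, smul_sub]
  have hfin : Module.finrank ℝ (Fin (k + 1) → EuclideanSpace ℝ (Fin n)) = (k + 1) * n := by
    simp [Module.finrank_pi_fintype]
  simp only [hleft] at hscale
  simp only [Pi.smul_apply, inv_smul_smul₀ hR.ne', hfin, smul_eq_mul] at hscale
  rw [← volume_pi, hscale, ← mul_assoc]
  congr 1
  rw [← Real.rpow_natCast, ← Real.rpow_neg hR.le, ← Real.rpow_add hR, hγ]
  congr 1
  push_cast
  field_simp
  ring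
end
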